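/- arXiv:2503.06020 — 2 statements merged into one kernel-verified Lean document; each statement's English description precedes it below -/
import Mathlib

section
/- Mass derivative identity. Assume d > 0, δ > 0, f is continuous, and (u,g,h) is a classical solution of the free boundary problem (c) with initial datum u₀ ∈ X(h₀) on [0,T). Then for every t ∈ (0,T), the function U(t) := ∫_{g(t)}^{h(t)} u(t,x) dx is differentiable with U'(t) = ∫_{g(t)}^{h(t)} f(t,x,u(t,x)) dx. (The boundary terms δ·h'(t) − δ·g'(t) cancel exactly with d·u_x(t,h(t)) − d·u_x(t,g(t)) thanks to the free boundary conditions.) -/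
open Set Filter

/-- A function `f` is of Allee type `(f_A)` with distinguished zero `θ ∈ [0,1)`. -/
def AlleeType (f : ℝ → ℝ) (θ : ℝ) : Prop :=
  ContDiffOn ℝ 1 f (Ici (0:ℝ)) ∧ θ ∈ Ico (0:ℝ) 1 ∧
    f 0 = 0 ∧ f θ = 0 ∧ f 1 = 0 ∧
    derivWithin f (Ici (0:ℝ)) 0 ≤ 0 ∧ derivWithin f (Ici (0:ℝ)) 1 < 0 ∧
    (∀ u ∈ Icc (0:ℝ) θ, f u ≤ 0) ∧ (∀ u ∈ Ioo θ (1:ℝ), 0 < f u) ∧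
    (∀ u ∈ Ioi (1:ℝ), f u < 0) ∧ 0 < ∫ s in (0:ℝ)..1, f s

/-- `θs` is the number `θ*_f ∈ [θ,1)` attached to an Allee type `f`. -/
def IsThetaStar (f : ℝ → ℝ) (θ θs : ℝ) : Prop :=
  θs ∈ Ico θ (1:ℝ) ∧ (∫ s in (0:ℝ)..θs, f s) = 0 ∧
    ∀ u ∈ Ioc θs (1:ℝ), 0 < ∫ s in (0:ℝ)..u, f s

/-- Membership in the initial class `X(h₀)`. -/
def InX (δ h₀ : ℝ) (φ : ℝ → ℝ) : Prop :=
  ContDiffOn ℝ 2 φ (Icc (-h₀) h₀) ∧ φ (-h₀) = δ ∧ φ h₀ = δ ∧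
    ∀ x ∈ Icc (-h₀) h₀, 0 < φ x

/-- A classical solution `(u,g,h)` of the free boundary problem (with reaction
term `f = f(t,x,u)`) with initial datum `u₀ ∈ X(h₀)` on the time interval `I`. -/
structure ClassicalSolution (d δ h₀ : ℝ) (f : ℝ → ℝ → ℝ → ℝ) (u₀ : ℝ → ℝ)
    (I : Set ℝ) (u : ℝ → ℝ → ℝ) (g h : ℝ → ℝ) : Prop where
  g_reg : ContDiffOn ℝ 1 g I
  h_reg : ContDiffOn ℝ 1 h I
  g_lt_h : ∀ t ∈ I, g t < h t
  u_cont : ContinuousOn (fun p : ℝ × ℝ => u p.1 p.2)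
      {p : ℝ × ℝ | p.1 ∈ I ∧ p.2 ∈ Icc (g p.1) (h p.1)}
  ux_cont : ContinuousOn (fun p : ℝ × ℝ => deriv (u p.1) p.2)
      {p : ℝ × ℝ | p.1 ∈ I ∧ 0 < p.1 ∧ p.2 ∈ Icc (g p.1) (h p.1)}
  ut_diff : ∀ t ∈ I, 0 < t → ∀ x ∈ Ioo (g t) (h t),
      DifferentiableAt ℝ (fun s => u s x) t
  ux_diff : ∀ t ∈ I, 0 < t → ∀ x ∈ Icc (g t) (h t), DifferentiableAt ℝ (u t) x
  uxx_diff : ∀ t ∈ I, 0 < t → ∀ x ∈ Ioo (g t) (h t),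
      DifferentiableAt ℝ (deriv (u t)) x
  ut_cont : ContinuousOn (fun p : ℝ × ℝ => deriv (fun s => u s p.2) p.1)
      {p : ℝ × ℝ | p.1 ∈ I ∧ 0 < p.1 ∧ p.2 ∈ Ioo (g p.1) (h p.1)}
  uxx_cont : ContinuousOn (fun p : ℝ × ℝ => deriv (deriv (u p.1)) p.2)
      {p : ℝ × ℝ | p.1 ∈ I ∧ 0 < p.1 ∧ p.2 ∈ Ioo (g p.1) (h p.1)}
  pde : ∀ t ∈ I, 0 < t → ∀ x ∈ Ioo (g t) (h t),
      deriv (fun s => u s x) t = d * deriv (deriv (u t)) x + f t x (u t x)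
  bc_g : ∀ t ∈ I, 0 < t → u t (g t) = δ
  bc_h : ∀ t ∈ I, 0 < t → u t (h t) = δ
  stefan_g : ∀ t ∈ I, 0 < t → deriv g t = -(d / δ) * deriv (u t) (g t)
  stefan_h : ∀ t ∈ I, 0 < t → deriv h t = -(d / δ) * deriv (u t) (h t)
  g_init : g 0 = -h₀
  h_init : h 0 = h₀
  u_init : ∀ x ∈ Icc (-h₀) h₀, u 0 x = u₀ x

/-- A semi-wave pair `(c,q)` for `(f, δ, d)`. -/
def SemiWavePair (d δ : ℝ) (f : ℝ → ℝ) (c : ℝ) (q : ℝ → ℝ) : Prop :=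
  0 < c ∧ ContDiffOn ℝ 2 q (Ici (0:ℝ)) ∧
    (∀ z ∈ Ici (0:ℝ),
      d * derivWithin (derivWithin q (Ici (0:ℝ))) (Ici (0:ℝ)) z
        - c * derivWithin q (Ici (0:ℝ)) z + f (q z) = 0) ∧
    (∀ z ∈ Ioi (0:ℝ), 0 < q z) ∧ q 0 = δ ∧
    Tendsto q atTop (nhds 1) ∧
    derivWithin q (Ici (0:ℝ)) 0 = c * δ / d ∧
    ∀ z ∈ Ici (0:ℝ), 0 < derivWithin q (Ici (0:ℝ)) z

/-- Condition `(f2)` with Hölder exponent `β`. -/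
def CondF2 (f : ℝ → ℝ → ℝ → ℝ) (β : ℝ) : Prop :=
  β ∈ Ioo (0:ℝ) 1 ∧
    (∀ M > 0, ∃ C > 0, ∀ t₁ ∈ Ici (0:ℝ), ∀ t₂ ∈ Ici (0:ℝ), ∀ x₁ x₂ : ℝ,
        ∀ v ∈ Icc (0:ℝ) M,
        |f t₁ x₁ v - f t₂ x₂ v| ≤ C * (|t₁ - t₂| ^ (β / 2) + |x₁ - x₂| ^ β)) ∧
    (∀ t ∈ Ici (0:ℝ), ∀ x : ℝ, ContDiffOn ℝ 1 (f t x) (Ici (0:ℝ))) ∧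
    (∀ t ∈ Ici (0:ℝ), ∀ x : ℝ, f t x 0 = 0) ∧
    (∀ M > 0, ∃ L > 0, ∀ t ∈ Ici (0:ℝ), ∀ x : ℝ,
        ∀ v₁ ∈ Icc (0:ℝ) M, ∀ v₂ ∈ Icc (0:ℝ) M,
        |f t x v₁ - f t x v₂| ≤ L * |v₁ - v₂|)

/-- Condition `(f3)` with constant `M₀`. -/
def CondF3 (f : ℝ → ℝ → ℝ → ℝ) (M₀ : ℝ) : Prop :=
  0 < M₀ ∧ ∀ t ∈ Ici (0:ℝ), ∀ x : ℝ, ∀ v, M₀ ≤ v → f t x v < 0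

/-- Part (i) of condition `(f4)`, with upper bound function `fbar`. -/
def CondF4i (f : ℝ → ℝ → ℝ → ℝ) (fbar : ℝ → ℝ) (β : ℝ) : Prop :=
  CondF2 f β ∧ (∀ t ∈ Ici (0:ℝ), ∀ x : ℝ, f t x 1 = 0) ∧
    ContinuousOn fbar (Ici (1:ℝ)) ∧
    ∀ t ∈ Ici (0:ℝ), ∀ x : ℝ, ∀ v, 1 < v → f t x v ≤ fbar v ∧ fbar v < 0

/-- Condition `(f4)`, with bounds `fbar` (above, for `u > 1`) and
`funder` (below, of Allee type). -/
def CondF4 (f : ℝ → ℝ → ℝ → ℝ) (fbar funder : ℝ → ℝ) (θ β : ℝ) : Prop :=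
  CondF4i f fbar β ∧ AlleeType funder θ ∧
    ∀ t ∈ Ici (0:ℝ), ∀ x : ℝ, ∀ v, 0 ≤ v → funder v ≤ f t x v

/-- Combustion-type nonlinearity `(f_c)` with ignition value `θ`. -/
def CombustionType (f : ℝ → ℝ) (θ : ℝ) : Prop :=
  ContDiffOn ℝ 1 f (Ici (0:ℝ)) ∧ θ ∈ Ioo (0:ℝ) 1 ∧
    (∀ u ∈ Icc (0:ℝ) θ, f u = 0) ∧ f 1 = 0 ∧ derivWithin f (Ici (0:ℝ)) 1 < 0 ∧
    (∀ u ∈ Ioo θ (1:ℝ), 0 < f u) ∧ (∀ u ∈ Ioi (1:ℝ), f u < 0)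

/-- The (unnormalised) bistable condition `(F_b)` with constants `0 < P < Q`. -/
def CondFb (F : ℝ → ℝ) (P Q : ℝ) : Prop :=
  0 < P ∧ P < Q ∧ ContDiffOn ℝ 1 F (Ici (0:ℝ)) ∧
    F 0 = 0 ∧ F P = 0 ∧ F Q = 0 ∧
    derivWithin F (Ici (0:ℝ)) 0 < 0 ∧ derivWithin F (Ici (0:ℝ)) Q < 0 ∧
    (∀ u ∈ Ioo (0:ℝ) P, F u < 0) ∧ (∀ u ∈ Ioi Q, F u < 0) ∧
    (∀ u ∈ Ioo P Q, 0 < F u) ∧ 0 < ∫ s in (0:ℝ)..Q, F s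

lemma md_moving {u : ℝ → ℝ → ℝ} {O : Set (ℝ × ℝ)} (hO : IsOpen O)
    (hOc : ∀ s x y, (s, x) ∈ O → (s, y) ∈ O → ∀ z ∈ uIcc x y, (s, z) ∈ O)
    (hu : ContinuousOn (fun p : ℝ × ℝ => u p.1 p.2) O)
    {t b' : ℝ} {b : ℝ → ℝ} (hb : HasDerivAt b b' t) (hm : (t, b t) ∈ O) :
    HasDerivAt (fun s => ∫ x in b t..b s, u s x) (u t (b t) * b') t := by
  have hii : ∀ s x y, (s, x) ∈ O → (s, y) ∈ O →
      IntervalIntegrable (u s) MeasureTheory.volume x y := by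
    intro s x y hx hy
    apply ContinuousOn.intervalIntegrable
    exact hu.comp (f := fun z => (s, z)) (by fun_prop) (fun z hz => hOc s x y hx hy z hz)
  have hbc := hb.continuousAt
  have h1 : ∀ᶠ s in nhds t, (s, b s) ∈ O :=
    (ContinuousAt.prodMk continuousAt_id hbc : ContinuousAt (fun s => (s, b s)) t)
      (hO.mem_nhds hm)
  have h2 : ∀ᶠ s in nhds t, (s, b t) ∈ O :=
    (ContinuousAt.prodMk continuousAt_id continuousAt_const :
      ContinuousAt (fun s => (s, b t)) t) (hO.mem_nhds hm)
  set c := u t (b t) with hc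
  have key : HasDerivAt (fun s => (∫ x in b t..b s, u s x) - c * (b s - b t)) 0 t := by
    rw [hasDerivAt_iff_isLittleO]
    refine Asymptotics.IsLittleO.trans_isBigO ?_ (hb.isBigO_sub)
    rw [Asymptotics.isLittleO_iff]
    intro e he
    have hcont : ContinuousAt (fun p : ℝ × ℝ => u p.1 p.2) (t, b t) :=
      hu.continuousAt (hO.mem_nhds hm)
    obtain ⟨r, hr, hball⟩ := Metric.continuousAt_iff.1 hcont e he
    have h3 : ∀ᶠ s in nhds t, dist s t < r := Metric.ball_mem_nhds t hr
    have h4 : ∀ᶠ s in nhds t, dist (b s) (b t) < r := hbc (Metric.ball_mem_nhds _ hr)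
    filter_upwards [h1, h2, h3, h4] with s m1 m2 m3 m4
    have e1 : (∫ x in b t..b s, u s x) - c * (b s - b t) = ∫ x in b t..b s, (u s x - c) := by
      rw [intervalIntegral.integral_sub (hii s _ _ m2 m1) (by simp)]
      simp [mul_comm]
    simp only [sub_self, intervalIntegral.integral_same, mul_zero, smul_zero, sub_zero]
    rw [e1]
    refine intervalIntegral.norm_integral_le_of_norm_le_const ?_
    intro x hx
    have hx' := uIoc_subset_uIcc hx
    have : dist ((s, x) : ℝ × ℝ) (t, b t) < r := by
      rw [Prod.dist_eq, max_lt_iff]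
      refine ⟨m3, lt_of_le_of_lt ?_ m4⟩
      simp only [Real.dist_eq]
      exact abs_sub_left_of_mem_uIcc hx'
    exact (hball this).le
  have := key.add ((hb.sub_const (b t)).const_mul c)
  refine (this.congr_of_eventuallyEq (Eventually.of_forall fun s => ?_)).congr_deriv (by ring)
  simp

lemma md_fixed {u ut : ℝ → ℝ → ℝ} {O : Set (ℝ × ℝ)} (hO : IsOpen O)
    (hu : ContinuousOn (fun p : ℝ × ℝ => u p.1 p.2) O)
    (hut : ContinuousOn (fun p : ℝ × ℝ => ut p.1 p.2) O)
    (hd : ∀ p ∈ O, HasDerivAt (fun s => u s p.2) (ut p.1 p.2) p.1)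
    {t a b : ℝ} (hm : ∀ x ∈ uIcc a b, (t, x) ∈ O) :
    HasDerivAt (fun s => ∫ x in a..b, u s x) (∫ x in a..b, ut t x) t := by
  obtain ⟨V, W, hV, hW, htV, hKW, hVW⟩ := generalized_tube_lemma (isCompact_singleton (x := t))
    (isCompact_uIcc (a := a) (b := b)) hO (by rintro ⟨s, x⟩ ⟨rfl, hx⟩; exact hm _ hx)
  obtain ⟨r, hr, hball⟩ := Metric.nhds_basis_closedBall.mem_iff.1
    (hV.mem_nhds (htV rfl))
  have hsub : Metric.closedBall t r ×ˢ uIcc a b ⊆ O := fun p hp => hVW ⟨hball hp.1, hKW hp.2⟩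
  obtain ⟨C, hC⟩ := ((isCompact_closedBall t r).prod (isCompact_uIcc (a := a)
    (b := b))).exists_bound_of_continuousOn (hut.mono hsub)
  have hsl : ∀ w : ℝ → ℝ → ℝ, ContinuousOn (fun p : ℝ × ℝ => w p.1 p.2) O →
      ∀ s ∈ Metric.closedBall t r, ContinuousOn (w s) (uIcc a b) := fun w hw s hs =>
    hw.comp (f := fun z => (s, z)) (by fun_prop) (fun z hz => hsub ⟨hs, hz⟩)
  have htr : t ∈ Metric.closedBall t r := Metric.mem_closedBall_self hr.le
  refine (intervalIntegral.hasDerivAt_integral_of_dominated_loc_of_deriv_le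
    (μ := MeasureTheory.volume) (F := u) (F' := ut) (bound := fun _ => C)
    (Metric.closedBall_mem_nhds t hr) ?_ ?_ ?_ ?_ ?_ ?_).2
  · filter_upwards [Metric.closedBall_mem_nhds t hr] with s hs
    exact ((hsl u hu s hs).mono uIoc_subset_uIcc).aestronglyMeasurable measurableSet_uIoc
  · exact (hsl u hu t htr).intervalIntegrable
  · exact ((hsl ut hut t htr).mono uIoc_subset_uIcc).aestronglyMeasurable measurableSet_uIoc
  · exact Eventually.of_forall fun x hx s hs => hC (s, x) ⟨hs, uIoc_subset_uIcc hx⟩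
  · simp
  · exact Eventually.of_forall fun x hx s hs => hd (s, x) (hsub ⟨hs, uIoc_subset_uIcc hx⟩)

lemma md_leibniz {u ut : ℝ → ℝ → ℝ} {O : Set (ℝ × ℝ)} (hO : IsOpen O)
    (hOc : ∀ s x y, (s, x) ∈ O → (s, y) ∈ O → ∀ z ∈ uIcc x y, (s, z) ∈ O)
    (hu : ContinuousOn (fun p : ℝ × ℝ => u p.1 p.2) O)
    (hut : ContinuousOn (fun p : ℝ × ℝ => ut p.1 p.2) O)
    (hd : ∀ p ∈ O, HasDerivAt (fun s => u s p.2) (ut p.1 p.2) p.1)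
    {t a' b' : ℝ} {a b : ℝ → ℝ} (ha : HasDerivAt a a' t) (hb : HasDerivAt b b' t)
    (hma : (t, a t) ∈ O) (hmb : (t, b t) ∈ O) :
    HasDerivAt (fun s => ∫ x in a s..b s, u s x)
      (u t (b t) * b' - u t (a t) * a' + ∫ x in a t..b t, ut t x) t := by
  have hii : ∀ s x y, (s, x) ∈ O → (s, y) ∈ O →
      IntervalIntegrable (u s) MeasureTheory.volume x y := by
    intro s x y hx hy
    apply ContinuousOn.intervalIntegrable
    exact hu.comp (f := fun z => (s, z)) (by fun_prop) (fun z hz => hOc s x y hx hy z hz)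
  have hev : ∀ c : ℝ → ℝ, ContinuousAt c t → (t, c t) ∈ O → ∀ᶠ s in nhds t, (s, c s) ∈ O :=
    fun c hc hm => (ContinuousAt.prodMk continuousAt_id hc : ContinuousAt (fun s => (s, c s)) t)
      (hO.mem_nhds hm)
  have key := ((md_moving hO hOc hu hb hmb).sub (md_moving hO hOc hu ha hma)).add
    (md_fixed hO hu hut hd (hOc t _ _ hma hmb))
  refine key.congr_of_eventuallyEq ?_
  filter_upwards [hev a ha.continuousAt hma, hev b hb.continuousAt hmb,
    hev (fun _ => a t) continuousAt_const hma, hev (fun _ => b t) continuousAt_const hmb]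
    with s m1 m2 m3 m4
  have e1 := intervalIntegral.integral_add_adjacent_intervals (hii s _ _ m1 m3) (hii s _ _ m3 m4)
  have e2 := intervalIntegral.integral_add_adjacent_intervals (hii s _ _ m1 m4) (hii s _ _ m4 m2)
  have e3 := intervalIntegral.integral_symm (f := u s) (μ := MeasureTheory.volume) (a t) (a s)
  simp only [Pi.add_apply, Pi.sub_apply]
  linarith

lemma md_param {F : ℝ → ℝ → ℝ} (hF : Continuous fun p : ℝ × ℝ => F p.1 p.2)
    {s a b : ℝ × ℝ → ℝ} (hs : Continuous s) (ha : Continuous a) (hb : Continuous b) :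
    Continuous fun q => ∫ x in a q..b q, F (s q) x := by
  have h0 := intervalIntegral.continuous_parametric_primitive_of_continuous
    (μ := MeasureTheory.volume) (f := F) (a₀ := 0) hF
  have h1 := (h0.comp (hs.prodMk hb)).sub (h0.comp (hs.prodMk ha))
  refine h1.congr fun q => ?_
  have hc : Continuous (F (s q)) := hF.comp (f := fun x => (s q, x)) (by fun_prop)
  exact intervalIntegral.integral_interval_sub_left (hc.intervalIntegrable _ _)
    (hc.intervalIntegrable _ _)

lemma md_unif {Φ : ℝ → ℝ → ℝ} (hΦ : Continuous fun p : ℝ × ℝ => Φ p.1 p.2) (S : Set ℝ)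
    (l : Filter ℝ) (hl : l ≤ nhds 0) :
    TendstoLocallyUniformlyOn Φ (Φ 0) l S := by
  let G : C(ℝ, C(ℝ, ℝ)) := ContinuousMap.curry ⟨fun p : ℝ × ℝ => Φ p.1 p.2, hΦ⟩
  have h1 : Tendsto (fun e => G e) l (nhds (G 0)) := (G.continuous.tendsto 0).mono_left hl
  have h2 := ContinuousMap.tendsto_iff_tendstoLocallyUniformly.1 h1
  exact h2.tendstoLocallyUniformlyOn

/-- the mass derivative identity. -/
theorem mass_derivative (d δ h₀ T : ℝ) (f : ℝ → ℝ → ℝ → ℝ)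
    (u₀ : ℝ → ℝ) (u : ℝ → ℝ → ℝ) (g h : ℝ → ℝ)
    (hd : 0 < d) (hδ : 0 < δ) (hh₀ : 0 < h₀) (hT : 0 < T)
    (hf : Continuous fun p : ℝ × ℝ × ℝ => f p.1 p.2.1 p.2.2)
    (hu₀ : InX δ h₀ u₀)
    (hsol : ClassicalSolution d δ h₀ f u₀ (Ico 0 T) u g h) :
    ∀ t ∈ Ioo (0:ℝ) T,
      HasDerivAt (fun s => ∫ x in g s..h s, u s x)
        (∫ x in g t..h t, f t x (u t x)) t := by
  intro t ht
  obtain ⟨α, hα0, hαt⟩ := exists_between ht.1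
  obtain ⟨β, htβ, hβT⟩ := exists_between ht.2
  have hJ : ∀ s, α ≤ s → s ≤ β → s ∈ Ico 0 T ∧ 0 < s := fun s h1 h2 =>
    ⟨⟨by linarith, by linarith⟩, by linarith⟩
  -- regularity of the free boundaries
  have hreg : ∀ k : ℝ → ℝ, ContDiffOn ℝ 1 k (Ico 0 T) →
      ContinuousOn k (Ioo 0 T) ∧ ContinuousOn (deriv k) (Ioo 0 T) ∧
        ∀ s ∈ Ioo 0 T, HasDerivAt k (deriv k s) s := by
    intro k hk
    have hk' := hk.mono (Ioo_subset_Ico_self (a := (0:ℝ)) (b := T))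
    exact ⟨hk'.continuousOn, hk'.continuousOn_deriv_of_isOpen isOpen_Ioo le_rfl,
      fun s hs => ((hk'.differentiableOn one_ne_zero).differentiableAt
        (isOpen_Ioo.mem_nhds hs)).hasDerivAt⟩
  obtain ⟨gc, gc', gd⟩ := hreg g hsol.g_reg
  obtain ⟨hc, hc', hhd⟩ := hreg h hsol.h_reg
  -- the open interior region
  let O : Set (ℝ × ℝ) := {p | p.1 ∈ Ioo 0 T ∧ g p.1 < p.2 ∧ p.2 < h p.1}
  have hO : IsOpen O := by
    have c1 : ContinuousOn (fun p : ℝ × ℝ => (p.2 - g p.1, h p.1 - p.2))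
        (Prod.fst ⁻¹' Ioo 0 T) := by
      have q1 : ContinuousOn (fun p : ℝ × ℝ => g p.1) (Prod.fst ⁻¹' Ioo 0 T) :=
        gc.comp (by fun_prop) (fun p hp => hp)
      have q2 : ContinuousOn (fun p : ℝ × ℝ => h p.1) (Prod.fst ⁻¹' Ioo 0 T) :=
        hc.comp (by fun_prop) (fun p hp => hp)
      exact (continuousOn_snd.sub q1).prodMk (q2.sub continuousOn_snd)
    have := c1.isOpen_inter_preimage (isOpen_Ioo.preimage continuous_fst)
      ((isOpen_Ioi (a := (0:ℝ))).prod (isOpen_Ioi (a := (0:ℝ))))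
    convert this using 1
    ext p
    simp [O]
  have hOc : ∀ s x y, (s, x) ∈ O → (s, y) ∈ O → ∀ z ∈ uIcc x y, (s, z) ∈ O := by
    rintro s x y ⟨h1, h2, h3⟩ ⟨-, h4, h5⟩ z hz
    rw [mem_uIcc] at hz
    refine ⟨h1, ?_, ?_⟩ <;> rcases hz with hz | hz <;> simp only at * <;> linarith [hz.1, hz.2]
  have hOI : ∀ p ∈ O, p.1 ∈ Ico 0 T ∧ 0 < p.1 ∧ p.2 ∈ Ioo (g p.1) (h p.1) :=
    fun p hp => ⟨⟨hp.1.1.le, hp.1.2⟩, hp.1.1, hp.2⟩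
  have hOI' : ∀ p ∈ O, p.1 ∈ Ico 0 T ∧ p.2 ∈ Icc (g p.1) (h p.1) :=
    fun p hp => ⟨⟨hp.1.1.le, hp.1.2⟩, hp.2.1.le, hp.2.2.le⟩
  have huO := hsol.u_cont.mono hOI'
  have hutO := hsol.ut_cont.mono hOI
  have hxxO := hsol.uxx_cont.mono hOI
  -- clamped functions
  let P : ℝ → ℝ := fun s => max α (min s β)
  have hP : Continuous P := by fun_prop
  have hPJ : ∀ s, α ≤ P s ∧ P s ≤ β := fun s =>
    ⟨le_max_left _ _, max_le (by linarith) (min_le_right _ _)⟩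
  have hPT : ∀ s, P s ∈ Ioo 0 T := fun s => ⟨by linarith [hPJ s], by linarith [hPJ s]⟩
  have hPid : ∀ s ∈ Ioo α β, P s = s := fun s hs => by
    simp only [P]; rw [min_eq_left hs.2.le, max_eq_right hs.1.le]
  let G : ℝ → ℝ := fun s => g (P s)
  let H : ℝ → ℝ := fun s => h (P s)
  let G' : ℝ → ℝ := fun s => deriv g (P s)
  let H' : ℝ → ℝ := fun s => deriv h (P s)
  have hG : Continuous G := gc.comp_continuous hP hPT
  have hH : Continuous H := hc.comp_continuous hP hPT
  have hG' : Continuous G' := gc'.comp_continuous hP hPT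
  have hH' : Continuous H' := hc'.comp_continuous hP hPT
  have hGH : ∀ s, G s < H s := fun s => hsol.g_lt_h _ (hJ _ (hPJ s).1 (hPJ s).2).1
  let X : ℝ → ℝ → ℝ := fun s x => max (G s) (min x (H s))
  have hX : Continuous fun p : ℝ × ℝ => X p.1 p.2 := by fun_prop
  have hXm : ∀ s x, X s x ∈ Icc (g (P s)) (h (P s)) := fun s x =>
    ⟨le_max_left _ _, max_le (hGH s).le (min_le_right _ _)⟩
  have hXid : ∀ s x, x ∈ Icc (G s) (H s) → X s x = x := fun s x hx => by
    simp only [X]; rw [min_eq_left hx.2, max_eq_right hx.1]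
  let V : ℝ → ℝ → ℝ := fun s x => u (P s) (X s x)
  let Vx : ℝ → ℝ → ℝ := fun s x => deriv (u (P s)) (X s x)
  let Fv : ℝ → ℝ → ℝ := fun s x => f (P s) (X s x) (V s x)
  have hPX : Continuous fun p : ℝ × ℝ => (P p.1, X p.1 p.2) :=
    (hP.comp continuous_fst).prodMk hX
  have hV : Continuous fun p : ℝ × ℝ => V p.1 p.2 :=
    hsol.u_cont.comp_continuous hPX (fun p => ⟨(hJ _ (hPJ p.1).1 (hPJ p.1).2).1, hXm _ _⟩)
  have hVx : Continuous fun p : ℝ × ℝ => Vx p.1 p.2 :=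
    hsol.ux_cont.comp_continuous hPX (fun p => ⟨(hJ _ (hPJ p.1).1 (hPJ p.1).2).1,
      (hPT p.1).1, hXm _ _⟩)
  have hFv : Continuous fun p : ℝ × ℝ => Fv p.1 p.2 :=
    hf.comp ((hP.comp continuous_fst).prodMk (hX.prodMk hV))
  -- shrunken intervals
  let A : ℝ → ℝ → ℝ := fun e s => G s + e * (H s - G s)
  let B : ℝ → ℝ → ℝ := fun e s => H s - e * (H s - G s)
  have hA : Continuous fun q : ℝ × ℝ => A q.1 q.2 := by fun_prop
  have hB : Continuous fun q : ℝ × ℝ => B q.1 q.2 := by fun_prop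
  let Φ : ℝ → ℝ → ℝ := fun e s =>
    V s (B e s) * (H' s - e * (H' s - G' s)) - V s (A e s) * (G' s + e * (H' s - G' s))
      + (d * (Vx s (B e s) - Vx s (A e s)) + ∫ x in A e s..B e s, Fv s x)
  have hΦ : Continuous fun q : ℝ × ℝ => Φ q.1 q.2 := by
    have i1 : Continuous fun q : ℝ × ℝ => ∫ x in A q.1 q.2..B q.1 q.2, Fv q.2 x :=
      md_param hFv continuous_snd hA hB
    have i2 : Continuous fun q : ℝ × ℝ => V q.2 (B q.1 q.2) :=
      hV.comp (continuous_snd.prodMk hB)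
    have i3 : Continuous fun q : ℝ × ℝ => V q.2 (A q.1 q.2) :=
      hV.comp (continuous_snd.prodMk hA)
    have i4 : Continuous fun q : ℝ × ℝ => Vx q.2 (B q.1 q.2) :=
      hVx.comp (continuous_snd.prodMk hB)
    have i5 : Continuous fun q : ℝ × ℝ => Vx q.2 (A q.1 q.2) :=
      hVx.comp (continuous_snd.prodMk hA)
    have i6 : Continuous fun q : ℝ × ℝ => H' q.2 := hH'.comp continuous_snd
    have i7 : Continuous fun q : ℝ × ℝ => G' q.2 := hG'.comp continuous_snd
    exact ((i2.mul (i6.sub (continuous_fst.mul (i6.sub i7)))).sub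
      (i3.mul (i7.add (continuous_fst.mul (i6.sub i7))))).add
      ((continuous_const.mul (i4.sub i5)).add i1)
  have hVid : ∀ s ∈ Ioo α β, ∀ x ∈ Icc (g s) (h s),
      V s x = u s x ∧ Vx s x = deriv (u s) x ∧ Fv s x = f s x (u s x) := by
    intro s hs x hx
    have e1 := hPid s hs
    have e2 : X s x = x := hXid s x (by simpa only [G, H, e1] using hx)
    simp only [V, Vx, Fv, e1, e2, and_self]
  have hpos : ∀ s ∈ Ioo α β, s ∈ Ico 0 T ∧ 0 < s := fun s hs => hJ s hs.1.le hs.2.le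
  -- value at zero
  have hzero : Φ 0 t = ∫ x in g t..h t, f t x (u t x) := by
    have hs : t ∈ Ioo α β := ⟨hαt, htβ⟩
    have e1 := hPid t hs
    obtain ⟨p1, p2⟩ := hpos t hs
    have hlt := hsol.g_lt_h t p1
    have eg := hVid t hs (g t) ⟨le_rfl, hlt.le⟩
    have eh := hVid t hs (h t) ⟨hlt.le, le_rfl⟩
    have ei : ∫ x in g t..h t, Fv t x = ∫ x in g t..h t, f t x (u t x) := by
      apply intervalIntegral.integral_congr
      intro x hx
      rw [uIcc_of_le hlt.le] at hx
      exact (hVid t hs x hx).2.2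
    simp only [Φ, A, B, G, H, G', H', e1, zero_mul, add_zero, sub_zero]
    rw [ei, eg.1, eh.1, eg.2.1, eh.2.1, hsol.bc_g t p1 p2, hsol.bc_h t p1 p2,
      hsol.stefan_g t p1 p2, hsol.stefan_h t p1 p2]
    field_simp
    ring
  rw [← hzero]
  refine hasDerivAt_of_tendstoLocallyUniformlyOn (l := nhdsWithin (0:ℝ) (Ioi 0))
    (f := fun e s => ∫ x in (g s + e * (h s - g s))..(h s - e * (h s - g s)), u s x)
    (isOpen_Ioo (a := α) (b := β)) (md_unif hΦ _ _ nhdsWithin_le_nhds) ?_ ?_ ⟨hαt, htβ⟩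
  · have hev : ∀ᶠ e in nhdsWithin (0:ℝ) (Ioi 0), e ∈ Ioo (0:ℝ) (1/2) :=
      Ioo_mem_nhdsGT (by norm_num)
    filter_upwards [hev] with e he s hs
    obtain ⟨p1, p2⟩ := hpos s hs
    have hsT : s ∈ Ioo 0 T := ⟨p2, p1.2⟩
    have e1 := hPid s hs
    have hlt := hsol.g_lt_h s p1
    have hw : 0 < h s - g s := by linarith
    have he1 := mul_pos he.1 hw
    have he2 : e * (h s - g s) < 1 / 2 * (h s - g s) := mul_lt_mul_of_pos_right he.2 hw
    have hma : (s, g s + e * (h s - g s)) ∈ O := ⟨hsT, by simp only; linarith, by simp only; linarith⟩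
    have hmb : (s, h s - e * (h s - g s)) ∈ O := ⟨hsT, by simp only; linarith, by simp only; linarith⟩
    have hab : g s + e * (h s - g s) ≤ h s - e * (h s - g s) := by linarith
    have hw' := ((hhd s hsT).sub (gd s hsT)).const_mul e
    have key := md_leibniz (u := u) (ut := fun s x => deriv (fun r => u r x) s) hO hOc huO hutO
      (fun p hp => (hsol.ut_diff p.1 (hOI p hp).1 (hOI p hp).2.1 p.2 (hOI p hp).2.2).hasDerivAt)
      (a := fun s => g s + e * (h s - g s)) (b := fun s => h s - e * (h s - g s))
      ((gd s hsT).add hw') ((hhd s hsT).sub hw') hma hmb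
    refine key.congr_deriv ?_
    have hin : ∀ x ∈ uIcc (g s + e * (h s - g s)) (h s - e * (h s - g s)), (s, x) ∈ O :=
      hOc s _ _ hma hmb
    have hcc : ∀ x, (s, x) ∈ O → x ∈ Icc (g s) (h s) := fun x hx => (hOI' _ hx).2
    have ixx : IntervalIntegrable (fun x => deriv (deriv (u s)) x) MeasureTheory.volume
        (g s + e * (h s - g s)) (h s - e * (h s - g s)) :=
      (hxxO.comp (f := fun z => (s, z)) (by fun_prop) hin).intervalIntegrable
    have hFs : Continuous (Fv s) := hFv.comp (f := fun x => (s, x)) (by fun_prop)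
    have ie : ∫ x in (g s + e * (h s - g s))..(h s - e * (h s - g s)), deriv (fun r => u r x) s
        = d * (deriv (u s) (h s - e * (h s - g s)) - deriv (u s) (g s + e * (h s - g s)))
          + ∫ x in (g s + e * (h s - g s))..(h s - e * (h s - g s)), Fv s x := by
      rw [← intervalIntegral.integral_eq_sub_of_hasDerivAt (fun x hx =>
        (hsol.uxx_diff s p1 p2 x (hOI _ (hin x hx)).2.2).hasDerivAt) ixx,
        ← intervalIntegral.integral_const_mul,
        ← intervalIntegral.integral_add (ixx.const_mul d) (hFs.intervalIntegrable _ _)]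
      apply intervalIntegral.integral_congr
      intro x hx
      simp only
      rw [hsol.pde s p1 p2 x (hOI _ (hin x hx)).2.2, (hVid s hs x (hcc x (hin x hx))).2.2]
    have ea := hVid s hs _ (hcc _ hma)
    have eb := hVid s hs _ (hcc _ hmb)
    simp only [Φ, A, B, G, H, G', H', e1]
    rw [ie, ea.1, eb.1, ea.2.1, eb.2.1]
  · intro s hs
    have e1 := hPid s hs
    have hlt := hsol.g_lt_h s (hpos s hs).1
    have hcont : Continuous fun q : ℝ × ℝ => ∫ x in A q.1 q.2..B q.1 q.2, V q.2 x :=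
      md_param hV continuous_snd hA hB
    have hcs : Continuous fun e : ℝ => ∫ x in A e s..B e s, V s x :=
      hcont.comp (f := fun e => (e, s)) (by fun_prop)
    have hl := (hcs.tendsto 0).mono_left (nhdsWithin_le_nhds (s := Ioi (0:ℝ)))
    have hcg : ∀ a ∈ Icc (g s) (h s), ∀ b ∈ Icc (g s) (h s),
        ∫ x in a..b, V s x = ∫ x in a..b, u s x := by
      intro a ha b hb
      apply intervalIntegral.integral_congr
      intro x hx
      exact (hVid s hs x (ordConnected_Icc.uIcc_subset ha hb hx)).1
    have hz : ∫ x in A 0 s..B 0 s, V s x = ∫ x in g s..h s, u s x := by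
      simp only [A, B, G, H, e1, zero_mul, add_zero, sub_zero]
      exact hcg _ ⟨le_rfl, hlt.le⟩ _ ⟨hlt.le, le_rfl⟩
    rw [hz] at hl
    refine hl.congr' ?_
    have hev : ∀ᶠ e in nhdsWithin (0:ℝ) (Ioi 0), e ∈ Ioo (0:ℝ) (1/2) :=
      Ioo_mem_nhdsGT (by norm_num)
    filter_upwards [hev] with e he
    have hw : 0 < h s - g s := by linarith
    have he1 := mul_pos he.1 hw
    have he2 : e * (h s - g s) < 1 / 2 * (h s - g s) := mul_lt_mul_of_pos_right he.2 hw
    simp only [A, B, G, H, e1]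
    exact hcg _ ⟨by linarith, by linarith⟩ _ ⟨by linarith, by linarith⟩
end

section
/- Eventual upper bound by δ when δ > 1 (Step 1 in the proof of Theorem 3.2). Assume δ > 1, f satisfies part (i) of condition (f4) with upper bound f̄, and (u,g,h) is a classical solution of the free boundary problem (c) with initial datum u₀ ∈ X(h₀) on [0,∞). Then there exists T₀ > 0 such that u(t,x) ≤ δ for all t ≥ T₀ and all x ∈ [g(t), h(t)]. Consequently h'(t) ≤ 0 ≤ g'(t) for all t ≥ T₀, so the limits lim_{t→∞} h(t) and lim_{t→∞} g(t) exist and are finite. -/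
open Set Filter

theorem aux_left_deriv {F : ℝ → ℝ} {F' t : ℝ} (hF : HasDerivAt F F' t)
    (hle : ∀ᶠ s in nhdsWithin t (Iio t), F s ≤ F t) : 0 ≤ F' := by
  have h1 : Tendsto (slope F t) (nhdsWithin t (Iio t)) (nhds F') :=
    (hasDerivAt_iff_tendsto_slope.1 hF).mono_left
      (nhdsWithin_mono _ (fun s hs => ne_of_lt hs))
  refine ge_of_tendsto h1 ?_
  filter_upwards [hle, self_mem_nhdsWithin] with s hs hst
  rw [slope_def_field]
  have : s < t := hst
  exact div_nonneg_of_nonpos (by linarith) (by linarith)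

theorem aux_right_deriv {F : ℝ → ℝ} {F' t : ℝ} (hF : HasDerivAt F F' t)
    (hle : ∀ᶠ s in nhdsWithin t (Ioi t), F s ≤ F t) : F' ≤ 0 := by
  have h1 : Tendsto (slope F t) (nhdsWithin t (Ioi t)) (nhds F') :=
    (hasDerivAt_iff_tendsto_slope.1 hF).mono_left
      (nhdsWithin_mono _ (fun s hs => ne_of_gt hs))
  refine le_of_tendsto h1 ?_
  filter_upwards [hle, self_mem_nhdsWithin] with s hs hst
  rw [slope_def_field]
  have : t < s := hst
  exact div_nonpos_of_nonpos_of_nonneg (by linarith) (by linarith)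

theorem aux_second {F : ℝ → ℝ} {x : ℝ} (hF : ContinuousAt F x) (hmax : IsLocalMax F x) :
    deriv (deriv F) x ≤ 0 := by
  by_contra hc
  push Not at hc
  have hmin := isLocalMin_of_deriv_deriv_pos hc hmax.deriv_eq_zero hF
  have hev : F =ᶠ[nhds x] fun _ => F x := by
    filter_upwards [hmax, hmin] with y h1 h2 using le_antisymm h1 h2
  have h2 := hev.deriv.deriv_eq
  simp at h2
  linarith

theorem aux_compact {g h : ℝ → ℝ} {a b : ℝ} (hg : ContinuousOn g (Icc a b))
    (hh : ContinuousOn h (Icc a b)) (hgh : ∀ t ∈ Icc a b, g t < h t) :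
    IsCompact {p : ℝ × ℝ | p.1 ∈ Icc a b ∧ p.2 ∈ Icc (g p.1) (h p.1)} := by
  have hc : IsCompact ((fun q : ℝ × ℝ => (q.1, g q.1 + q.2 * (h q.1 - g q.1))) ''
      (Icc a b ×ˢ Icc (0:ℝ) 1)) := by
    apply (isCompact_Icc.prod isCompact_Icc).image_of_continuousOn
    have hg' : ContinuousOn (fun q : ℝ × ℝ => g q.1) (Icc a b ×ˢ Icc (0:ℝ) 1) :=
      hg.comp continuousOn_fst (fun q hq => hq.1)
    have hh' : ContinuousOn (fun q : ℝ × ℝ => h q.1) (Icc a b ×ˢ Icc (0:ℝ) 1) :=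
      hh.comp continuousOn_fst (fun q hq => hq.1)
    exact continuousOn_fst.prodMk (hg'.add (continuousOn_snd.mul (hh'.sub hg')))
  convert hc using 1
  ext ⟨t, x⟩
  simp only [mem_ofPred_eq, mem_image, mem_prod, Prod.exists, Prod.mk.injEq]
  constructor
  · rintro ⟨ht, h1, h2⟩
    have hl := hgh t ht
    refine ⟨t, (x - g t) / (h t - g t), ⟨ht, ?_, ?_⟩, rfl, ?_⟩
    · exact div_nonneg (by linarith) (by linarith)
    · rw [div_le_one (by linarith)]; linarith
    · rw [div_mul_cancel₀ _ (sub_pos.2 hl).ne']; ring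
  · rintro ⟨t', s, ⟨ht, h0, h1⟩, rfl, rfl⟩
    have hl := hgh _ ht
    exact ⟨ht, by nlinarith, by nlinarith⟩

theorem aux_mp {d δ h₀ : ℝ} {f : ℝ → ℝ → ℝ → ℝ}
    {u₀ : ℝ → ℝ} {u : ℝ → ℝ → ℝ} {g h : ℝ → ℝ}
    (hd : 0 < d)
    (hsol : ClassicalSolution d δ h₀ f u₀ (Ici (0:ℝ)) u g h)
    {a b M ε : ℝ} (ha : 0 ≤ a)
    (hinit : ∀ x ∈ Icc (g a) (h a), u a x ≤ M)
    (hδ : ∀ t ∈ Icc a b, δ ≤ M - ε * (t - a))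
    (hf : ∀ t ∈ Icc a b, ∀ x ∈ Icc (g t) (h t), M - ε * (t - a) < u t x →
      f t x (u t x) < -ε) :
    ∀ t ∈ Icc a b, ∀ x ∈ Icc (g t) (h t), u t x ≤ M - ε * (t - a) := by
  intro t₁ ht₁ x₁ hx₁
  have hsub : Icc a b ⊆ Ici (0:ℝ) := fun t ht => ha.trans ht.1
  have hgc : ContinuousOn g (Ici 0) := hsol.g_reg.continuousOn
  have hhc : ContinuousOn h (Ici 0) := hsol.h_reg.continuousOn
  have hK := aux_compact (hgc.mono hsub) (hhc.mono hsub)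
    (fun t ht => hsol.g_lt_h t (hsub ht))
  have huc : ContinuousOn (fun p : ℝ × ℝ => u p.1 p.2 + ε * p.1)
      {p : ℝ × ℝ | p.1 ∈ Icc a b ∧ p.2 ∈ Icc (g p.1) (h p.1)} :=
    (hsol.u_cont.mono (fun p hp => ⟨hsub hp.1, hp.2⟩)).add (by fun_prop)
  obtain ⟨⟨t, x⟩, ⟨ht, hx⟩, hmax⟩ := hK.exists_isMaxOn ⟨(t₁, x₁), ht₁, hx₁⟩ huc
  have hmax' : ∀ s ∈ Icc a b, ∀ y ∈ Icc (g s) (h s), u s y + ε * s ≤ u t x + ε * t :=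
    fun s hs y hy => hmax (show (s, y) ∈ {p : ℝ × ℝ | p.1 ∈ Icc a b ∧ p.2 ∈ Icc (g p.1) (h p.1)}
      from ⟨hs, hy⟩)
  simp only at ht hx
  by_contra hcon
  push Not at hcon
  have hbig : M - ε * (t - a) < u t x := by
    have := hmax' t₁ ht₁ x₁ hx₁
    nlinarith
  have hat : a < t := by
    rcases eq_or_lt_of_le ht.1 with he | hl
    · subst he
      have := hinit x hx
      simp at hbig
      linarith
    · exact hl
  have ht0 : 0 < t := ha.trans_lt hat
  have htI : t ∈ Ici (0:ℝ) := ht0.le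
  have hδt := hδ t ht
  have hxg : g t < x := by
    rcases eq_or_lt_of_le hx.1 with he | hl
    · have := hsol.bc_g t htI ht0
      rw [he] at this
      linarith
    · exact hl
  have hxh : x < h t := by
    rcases eq_or_lt_of_le hx.2 with he | hl
    · have := hsol.bc_h t htI ht0
      rw [← he] at this
      linarith
    · exact hl
  have hxx : deriv (deriv (u t)) x ≤ 0 := by
    apply aux_second (hsol.ux_diff t htI ht0 x hx).continuousAt
    filter_upwards [Ioo_mem_nhds hxg hxh] with y hy
    have := hmax' t ht y (Ioo_subset_Icc_self hy)
    linarith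
  have hgt : ContinuousAt g t := hgc.continuousAt (Ici_mem_nhds ht0)
  have hht : ContinuousAt h t := hhc.continuousAt (Ici_mem_nhds ht0)
  have hut : 0 ≤ deriv (fun s => u s x) t + ε := by
    have hD : HasDerivAt (fun s => u s x + ε * s) (deriv (fun s => u s x) t + ε) t := by
      have h1 := (hsol.ut_diff t htI ht0 x ⟨hxg, hxh⟩).hasDerivAt
      have h2 := (hasDerivAt_id t).const_mul ε
      have h3 := h1.add h2
      rw [mul_one] at h3
      exact h3
    apply aux_left_deriv hD
    filter_upwards [self_mem_nhdsWithin, nhdsWithin_le_nhds (Ioi_mem_nhds hat),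
      nhdsWithin_le_nhds (hgt.eventually_lt continuousAt_const hxg),
      nhdsWithin_le_nhds (continuousAt_const.eventually_lt hht hxh)] with s h1 h2 h3 h4
    have h1' : s < t := h1
    have h2' : a < s := h2
    exact hmax' s ⟨h2'.le, h1'.le.trans ht.2⟩ x ⟨le_of_lt h3, le_of_lt h4⟩
  have hp := hsol.pde t htI ht0 x ⟨hxg, hxh⟩
  have hfl := hf t ht x hx hbig
  have : d * deriv (deriv (u t)) x ≤ 0 := mul_nonpos_of_nonneg_of_nonpos hd.le hxx
  linarith

theorem aux_lim {h : ℝ → ℝ} {T B : ℝ} (ha : AntitoneOn h (Ici T)) (hB : ∀ t ≥ T, B ≤ h t) :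
    ∃ l : ℝ, Tendsto h atTop (nhds l) := by
  have hanti : Antitone (fun t => h (max t T)) := fun s t hst =>
    ha (mem_Ici.2 (le_max_right _ _)) (mem_Ici.2 (le_max_right _ _)) (max_le_max_right _ hst)
  have hbdd : BddBelow (range (fun t => h (max t T))) := by
    refine ⟨B, ?_⟩
    rintro _ ⟨t, rfl⟩
    exact hB _ (le_max_right _ _)
  refine ⟨_, (tendsto_atTop_ciInf hanti hbdd).congr' ?_⟩
  filter_upwards [eventually_ge_atTop T] with t ht
  rw [max_eq_left ht]

/-- eventual upper bound by `δ` when `δ > 1` (Step 1 of the proof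
of Theorem 3.2). -/
theorem eventually_le_delta (d δ h₀ β : ℝ) (f : ℝ → ℝ → ℝ → ℝ)
    (fbar u₀ : ℝ → ℝ) (u : ℝ → ℝ → ℝ) (g h : ℝ → ℝ)
    (hd : 0 < d) (hh₀ : 0 < h₀) (hδ : 1 < δ)
    (hf4i : CondF4i f fbar β)
    (hu₀ : InX δ h₀ u₀)
    (hsol : ClassicalSolution d δ h₀ f u₀ (Ici (0:ℝ)) u g h) :
    ∃ T₀ > 0, (∀ t ≥ T₀, ∀ x ∈ Icc (g t) (h t), u t x ≤ δ) ∧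
      (∀ t ≥ T₀, deriv h t ≤ 0 ∧ 0 ≤ deriv g t) ∧
      (∃ hinf : ℝ, Tendsto h atTop (nhds hinf)) ∧
      (∃ ginf : ℝ, Tendsto g atTop (nhds ginf)) := by
  obtain ⟨-, -, hfc, hfb⟩ := hf4i
  have h00 : (0:ℝ) ∈ Ici (0:ℝ) := self_mem_Ici
  -- maximum of the initial datum
  obtain ⟨M, hδM, hM⟩ : ∃ M, δ ≤ M ∧ ∀ x ∈ Icc (g 0) (h 0), u 0 x ≤ M := by
    rw [hsol.g_init, hsol.h_init]
    obtain ⟨C, hC⟩ := (isCompact_Icc (a := -h₀) (b := h₀)).bddAbove_image hu₀.1.continuousOn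
    refine ⟨max C δ, le_max_right _ _, fun x hx => ?_⟩
    rw [hsol.u_init x hx]
    exact (hC ⟨x, hx, rfl⟩).trans (le_max_left _ _)
  have hub : ∀ t ≥ 0, ∀ x ∈ Icc (g t) (h t), u t x ≤ M := by
    intro t ht x hx
    have := aux_mp hd hsol (a := 0) (b := t) (M := M) (ε := 0) le_rfl hM
      (fun s _ => by simpa using hδM)
      (fun s hs y _ hy => by
        have hb := hfb s hs.1 y (u s y) (by simp at hy; linarith)
        simp only [neg_zero]
        linarith [hb.1, hb.2]) t ⟨ht, le_rfl⟩ x hx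
    simpa using this
  obtain ⟨v₀, hv₀, hvmax⟩ := (isCompact_Icc (a := δ) (b := M)).exists_isMaxOn
    ⟨δ, le_rfl, hδM⟩ (hfc.mono (fun v hv => hδ.le.trans hv.1))
  have hneg : fbar v₀ < 0 := (hfb 0 h00 0 v₀ (hδ.trans_le hv₀.1)).2
  obtain ⟨ε, hε, hεv⟩ : ∃ ε > 0, fbar v₀ < -ε := ⟨-fbar v₀ / 2, by linarith, by linarith⟩
  set T : ℝ := (M - δ) / ε with hT
  have hT0 : 0 ≤ T := div_nonneg (by linarith) hε.le
  have hTε : ε * T = M - δ := by rw [hT]; field_simp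
  have hdec := aux_mp hd hsol (a := 0) (b := T) (M := M) (ε := ε) le_rfl hM
    (fun s hs => by nlinarith [hs.2])
    (fun s hs y hy hlt => by
      have h1 : δ < u s y := by nlinarith [hs.2]
      have h2 := hub s hs.1 y hy
      have h3 : fbar (u s y) ≤ fbar v₀ := hvmax ⟨h1.le, h2⟩
      have h4 := (hfb s hs.1 y (u s y) (hδ.trans h1)).1
      linarith)
  have hTd : ∀ x ∈ Icc (g T) (h T), u T x ≤ δ := by
    intro x hx
    have := hdec T ⟨hT0, le_rfl⟩ x hx
    linarith
  have hle : ∀ t ≥ T, ∀ x ∈ Icc (g t) (h t), u t x ≤ δ := by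
    intro t ht x hx
    have := aux_mp hd hsol (a := T) (b := t) (M := δ) (ε := 0) hT0 hTd
      (fun s _ => by simp)
      (fun s hs y _ hy => by
        have hb := hfb s (hT0.trans hs.1) y (u s y) (by simp at hy; linarith)
        simp only [neg_zero]
        linarith [hb.1, hb.2]) t ⟨ht, le_rfl⟩ x hx
    simpa using this
  have hdδ : 0 < d / δ := div_pos hd (by linarith)
  have hsign : ∀ t ≥ T + 1, deriv h t ≤ 0 ∧ 0 ≤ deriv g t := by
    intro t ht
    have ht0 : 0 < t := by linarith
    have hlt := hsol.g_lt_h t ht0.le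
    have hleft : h t ∈ Icc (g t) (h t) := ⟨hlt.le, le_rfl⟩
    have hright : g t ∈ Icc (g t) (h t) := ⟨le_rfl, hlt.le⟩
    have hT' : t ≥ T := by linarith
    constructor
    · rw [hsol.stefan_h t ht0.le ht0]
      have := aux_left_deriv (hsol.ux_diff t ht0.le ht0 _ hleft).hasDerivAt (by
        rw [hsol.bc_h t ht0.le ht0]
        filter_upwards [Ioo_mem_nhdsLT hlt] with y hy
        exact hle t hT' y (Ioo_subset_Icc_self hy))
      nlinarith
    · rw [hsol.stefan_g t ht0.le ht0]
      have := aux_right_deriv (hsol.ux_diff t ht0.le ht0 _ hright).hasDerivAt (by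
        rw [hsol.bc_g t ht0.le ht0]
        filter_upwards [Ioo_mem_nhdsGT hlt] with y hy
        exact hle t hT' y (Ioo_subset_Icc_self hy))
      nlinarith
  have hsub : Ici (T + 1) ⊆ Ici (0:ℝ) := Ici_subset_Ici.2 (by linarith)
  have hdiff : ∀ k : ℝ → ℝ, ContDiffOn ℝ 1 k (Ici 0) →
      DifferentiableOn ℝ k (interior (Ici (T + 1))) := by
    intro k hk
    exact (hk.differentiableOn (by simp)).mono (interior_subset.trans hsub)
  have hanti : AntitoneOn h (Ici (T + 1)) :=
    antitoneOn_of_deriv_nonpos (convex_Ici _) (hsol.h_reg.continuousOn.mono hsub)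
      (hdiff h hsol.h_reg) (fun t ht => (hsign t (interior_subset ht)).1)
  have hmono : MonotoneOn g (Ici (T + 1)) :=
    monotoneOn_of_deriv_nonneg (convex_Ici _) (hsol.g_reg.continuousOn.mono hsub)
      (hdiff g hsol.g_reg) (fun t ht => (hsign t (interior_subset ht)).2)
  have hTT : T + 1 ∈ Ici (T + 1) := self_mem_Ici
  refine ⟨T + 1, by linarith, fun t ht => hle t (by linarith), hsign, ?_, ?_⟩
  · refine aux_lim (B := g (T + 1)) hanti (fun t ht => ?_)
    exact (hmono hTT ht ht).trans (hsol.g_lt_h t (hsub ht)).le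
  · obtain ⟨l, hl⟩ := aux_lim (h := fun t => - g t) (B := - h (T + 1)) hmono.neg (fun t ht => by
      have h1 := hanti hTT ht ht
      have h2 := hsol.g_lt_h t (hsub ht)
      linarith)
    exact ⟨-l, by simpa using hl.neg⟩
end
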